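/- For a memoryless point-to-point communication system with strictly causal encoder (converse direction of Theorem 3): if a pmf P_{SXYŜ} on 𝒮×𝒳×𝒴×Ŝ is achievable with a strictly causal encoder, then there exist a finite set 𝒱 and a joint pmf P_{SXYŜV} whose (S,X,Y,Ŝ)-marginal is P_{SXYŜ}, which factors as P_S(s)·P_X(x)·P_{V|XS}(v|x,s)·P_{Y|X}(y|x)·P_{Ŝ|VY}(ŝ|v,y), and which satisfies I(X,V;S) ≤ I(X,V;Y). -/

import Mathlib

open scoped BigOperators

noncomputable section

/-- `p` is a probability mass function on the finite type `α`. -/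
def IsPMF {α : Type*} [Fintype α] (p : α → ℝ) : Prop :=
  (∀ a, 0 ≤ p a) ∧ (∑ a, p a) = 1

/-- Probability of the event `E` under the pmf `P`. -/
def prob {Ω : Type*} [Fintype Ω] (P : Ω → ℝ) (E : Set Ω) : ℝ :=
  ∑ ω, E.indicator P ω

/-- Probability that the random variable `f` takes the value `a`, under `P`. -/
def margProb {Ω A : Type*} [Fintype Ω] (P : Ω → ℝ) (f : Ω → A) (a : A) : ℝ :=
  prob P {ω | f ω = a}

/-- Mutual information `I(f;g)` (base-2 logarithms) of random variables `f`, `g`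
defined on a finite probability space with pmf `P`. -/
def mutInfo {Ω A B : Type*} [Fintype Ω] [Fintype A] [Fintype B]
    (P : Ω → ℝ) (f : Ω → A) (g : Ω → B) : ℝ :=
  ∑ a : A, ∑ b : B,
    margProb P (fun ω => (f ω, g ω)) (a, b) *
      Real.logb 2 (margProb P (fun ω => (f ω, g ω)) (a, b) /
        (margProb P f a * margProb P g b))

/-- Conditional mutual information `I(f;g|h)` (base-2 logarithms). -/
def condMutInfo {Ω A B C : Type*} [Fintype Ω] [Fintype A] [Fintype B] [Fintype C]
    (P : Ω → ℝ) (f : Ω → A) (g : Ω → B) (h : Ω → C) : ℝ :=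
  ∑ a : A, ∑ b : B, ∑ c : C,
    margProb P (fun ω => (f ω, g ω, h ω)) (a, b, c) *
      Real.logb 2
        ((margProb P (fun ω => (f ω, g ω, h ω)) (a, b, c) * margProb P h c) /
          (margProb P (fun ω => (f ω, h ω)) (a, c) *
            margProb P (fun ω => (g ω, h ω)) (b, c)))

/-- Total variation distance between two pmfs: half the ℓ¹ distance. -/
def tvDist {α : Type*} [Fintype α] (P Q : α → ℝ) : ℝ :=
  (∑ a, |P a - Q a|) / 2

/-- Empirical distribution of the sequence `w`. -/
def empDist {n : ℕ} {α : Type*} (w : Fin n → α) (a : α) : ℝ :=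
  (∑ i : Fin n, ({i | w i = a} : Set (Fin n)).indicator (fun _ => (1 : ℝ)) i) / n

/-- Causality classes for the encoder. -/
inductive EncoderClass | noncausal | causal | strictlyCausal

/-- The encoder `f` respects the causality class `c`:
a noncausal encoder has `Xᵢ = fᵢ(Sⁿ)`, a causal encoder has `Xᵢ = fᵢ(Sⁱ)`
(it only depends on `S₁,…,Sᵢ`), and a strictly causal encoder has
`Xᵢ = fᵢ(Sⁱ⁻¹)` (it only depends on `S₁,…,Sᵢ₋₁`). -/
def EncOK {n : ℕ} {S X : Type*} : EncoderClass → (Fin n → (Fin n → S) → X) → Prop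
  | .noncausal, _ => True
  | .causal, f => ∀ (i : Fin n) (s s' : Fin n → S),
      (∀ j, j ≤ i → s j = s' j) → f i s = f i s'
  | .strictlyCausal, f => ∀ (i : Fin n) (s s' : Fin n → S),
      (∀ j, j < i → s j = s' j) → f i s = f i s'

/-- The joint pmf of `(Sⁿ, Yⁿ)` induced by the i.i.d. source `PS`, the memoryless
channel `PYX` and the (deterministic) encoder `f`. -/
def inducedP {S X Y : Type*} {n : ℕ}
    (PS : S → ℝ) (PYX : X → Y → ℝ) (f : Fin n → (Fin n → S) → X) :
    (Fin n → S) × (Fin n → Y) → ℝ :=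
  fun sy => (∏ i, PS (sy.1 i)) * ∏ i, PYX (f i sy.1) (sy.2 i)

/-- `P` (a pmf on `S × X × Y × Z`) is achievable for the source `PS` and channel `PYX`
with an encoder of causality class `c`: for every `ε > 0` there are a block length
`n` and a block-`n` code such that with probability at least `1 - ε` the empirical
distribution of `(Sⁿ, Xⁿ, Yⁿ, Ŝⁿ)` is within total variation `ε` of `P`. -/
def Achievable {S X Y Z : Type*} [Fintype S] [Fintype X] [Fintype Y] [Fintype Z]
    (PS : S → ℝ) (PYX : X → Y → ℝ) (c : EncoderClass)
    (P : S × X × Y × Z → ℝ) : Prop :=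
  ∀ ε : ℝ, 0 < ε →
    ∃ n : ℕ, 0 < n ∧
      ∃ (f : Fin n → (Fin n → S) → X) (g : Fin n → (Fin n → Y) → Z),
        EncOK c f ∧
        prob (inducedP PS PYX f)
          {sy | ε <
            tvDist (empDist (fun i => (sy.1 i, f i sy.1, sy.2 i, g i sy.2))) P} < ε

/-- Shannon entropy (natural logarithm) of the random variable `f` under `P`. -/
def entropyOf {Ω A : Type*} [Fintype Ω] [Fintype A] (P : Ω → ℝ) (f : Ω → A) : ℝ :=
  ∑ a, Real.negMulLog (margProb P f a)

section FiniteProbability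

variable {Ω A B : Type*} [Fintype Ω]

open Classical in
lemma margProb_eq_sum_ite (P : Ω → ℝ) (f : Ω → A) (a : A) :
    margProb P f a = ∑ ω, if f ω = a then P ω else 0 := by
  simp [margProb, prob, Set.indicator_apply]

lemma margProb_nonneg {P : Ω → ℝ} (hP : ∀ ω, 0 ≤ P ω) (f : Ω → A) (a : A) :
    0 ≤ margProb P f a := by
  classical
  rw [margProb_eq_sum_ite]
  exact Finset.sum_nonneg fun ω _ => by split_ifs <;> simp [hP]

variable [Fintype A] [Fintype B]

lemma sum_margProb_mul (P : Ω → ℝ) (f : Ω → A) (φ : A → ℝ) :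
    ∑ a, margProb P f a * φ a = ∑ ω, P ω * φ (f ω) := by
  classical
  simp_rw [margProb_eq_sum_ite, Finset.sum_mul]
  rw [Finset.sum_comm]
  simp [ite_mul]

lemma sum_margProb (P : Ω → ℝ) (f : Ω → A) : ∑ a, margProb P f a = ∑ ω, P ω := by
  simpa using sum_margProb_mul P f 1

omit [Fintype A] in
lemma sum_margProb_prod (P : Ω → ℝ) (f : Ω → A) (g : Ω → B) (a : A) :
    ∑ b, margProb P (fun ω => (f ω, g ω)) (a, b) = margProb P f a := by
  classical
  simp_rw [margProb_eq_sum_ite, Prod.mk.injEq]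
  rw [Finset.sum_comm]
  refine Finset.sum_congr rfl fun ω _ => ?_
  by_cases h : f ω = a <;> simp [h]

lemma entropyOf_eq_sum (P : Ω → ℝ) (f : Ω → A) :
    entropyOf P f = -∑ ω, P ω * Real.log (margProb P f (f ω)) := by
  rw [← sum_margProb_mul P f fun a => Real.log (margProb P f a)]
  simp [entropyOf, Real.negMulLog, Finset.sum_neg_distrib]

lemma entropyOf_congr (P : Ω → ℝ) {f : Ω → A} {g : Ω → B}
    (h : ∀ ω ω', f ω = f ω' ↔ g ω = g ω') : entropyOf P f = entropyOf P g := by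
  classical
  simp_rw [entropyOf_eq_sum, margProb_eq_sum_ite, h]

/-- If `g` is drawn from the kernel `κ (f ω)`, then the joint entropy of `f` and `g` is the entropy
of `f` plus the mean entropy of the kernel. -/
lemma entropyOf_prod_of_kernel (P : Ω → ℝ) (f : Ω → A) (g : Ω → B) (κ : A → B → ℝ)
    (hκ : ∀ a, ∑ b, κ a b = 1)
    (h : ∀ a b, margProb P (fun ω => (f ω, g ω)) (a, b) = margProb P f a * κ a b) :
    entropyOf P (fun ω => (f ω, g ω)) =
      entropyOf P f + ∑ ω, P ω * ∑ b, Real.negMulLog (κ (f ω) b) := by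
  rw [← sum_margProb_mul P f fun a => ∑ b, Real.negMulLog (κ a b)]
  simp_rw [entropyOf, Fintype.sum_prod_type, h, Real.negMulLog_mul, Finset.sum_add_distrib,
    ← Finset.sum_mul, ← Finset.mul_sum, hκ, one_mul]

/-- Gibbs' inequality, for a measure `u` of arbitrary mass. -/
lemma sum_negMulLog_sub_le {u q : A → ℝ} (hu : ∀ a, 0 ≤ u a) (hq : ∀ a, 0 ≤ q a)
    (hq1 : ∑ a, q a ≤ 1) (hac : ∀ a, q a = 0 → u a = 0) :
    ∑ a, Real.negMulLog (u a) - Real.negMulLog (∑ a, u a) ≤ -∑ a, u a * Real.log (q a) := by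
  set U := ∑ a, u a with hU
  have hU0 : 0 ≤ U := Finset.sum_nonneg fun a _ => hu a
  have key : ∀ a, Real.negMulLog (u a) + u a * Real.log (q a) + u a * Real.log U
      ≤ q a * U - u a := by
    intro a
    rcases (hu a).eq_or_lt with h0 | h0
    · simp [← h0, mul_nonneg (hq a) hU0]
    · have hqa : 0 < q a := lt_of_le_of_ne (hq a) fun h => h0.ne' (hac a h.symm)
      have hUp : 0 < U := lt_of_lt_of_le h0 (Finset.single_le_sum (fun b _ => hu b)
        (Finset.mem_univ a))
      have hlog := Real.log_le_sub_one_of_pos (div_pos (mul_pos hqa hUp) h0)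
      rw [Real.log_div (mul_pos hqa hUp).ne' h0.ne', Real.log_mul hqa.ne' hUp.ne'] at hlog
      have hmul := mul_le_mul_of_nonneg_left hlog h0.le
      have : u a * (q a * U / u a - 1) = q a * U - u a := by field_simp
      rw [this] at hmul
      rw [Real.negMulLog]
      linarith
  have hsum := Finset.sum_le_sum fun a (_ : a ∈ Finset.univ) => key a
  simp_rw [Finset.sum_add_distrib, Finset.sum_sub_distrib, ← Finset.sum_mul, ← hU] at hsum
  have hle : (∑ a, q a) * U ≤ U := mul_le_of_le_one_left hU0 hq1
  rw [Real.negMulLog]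
  linarith

/-- The case of equality in Gibbs' inequality. -/
lemma sum_negMulLog_sub_eq {u : A → ℝ} (hu : ∀ a, 0 ≤ u a) :
    ∑ a, Real.negMulLog (u a) - Real.negMulLog (∑ a, u a) =
      -∑ a, u a * Real.log (u a / ∑ b, u b) := by
  have key : ∀ a, u a * Real.log (u a / ∑ b, u b) =
      u a * Real.log (∑ b, u b) * (-1) - Real.negMulLog (u a) := by
    intro a
    rcases (hu a).eq_or_lt with h0 | h0
    · simp [← h0]
    · have hUp : 0 < ∑ b, u b := lt_of_lt_of_le h0 (Finset.single_le_sum (fun b _ => hu b)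
        (Finset.mem_univ a))
      rw [Real.log_div h0.ne' hUp.ne', Real.negMulLog]
      ring
  simp_rw [key, Finset.sum_sub_distrib, ← Finset.sum_mul, Real.negMulLog]
  ring

/-- Mutual information between the input and the output of a kernel `κ` with input law `α`. -/
lemma mutInfo_of_kernel (Q : Ω → ℝ) (f : Ω → A) (g : Ω → B) (α : A → ℝ) (κ : A → B → ℝ)
    (hα : ∀ a, 0 ≤ α a) (hκ : ∀ a b, 0 ≤ κ a b) (hκ1 : ∀ a, ∑ b, κ a b = 1)
    (h : ∀ a b, margProb Q (fun ω => (f ω, g ω)) (a, b) = α a * κ a b) :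
    mutInfo Q f g = (∑ b, Real.negMulLog (margProb Q g b)
      - ∑ a, α a * ∑ b, Real.negMulLog (κ a b)) / Real.log 2 := by
  have hf : ∀ a, margProb Q f a = α a := fun a => by
    rw [← sum_margProb_prod Q f g]
    simp_rw [h, ← Finset.mul_sum, hκ1, mul_one]
  have hg : ∀ b, margProb Q g b = ∑ a, α a * κ a b := fun b => by
    classical
    simp_rw [← h, margProb_eq_sum_ite, Prod.mk.injEq]
    rw [Finset.sum_comm]
    refine Finset.sum_congr rfl fun ω _ => ?_
    by_cases hb : g ω = b <;> simp [hb]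
  have term : ∀ a b, margProb Q (fun ω => (f ω, g ω)) (a, b) *
      Real.logb 2 (margProb Q (fun ω => (f ω, g ω)) (a, b) / (margProb Q f a * margProb Q g b)) =
      (-(α a * κ a b * Real.log (margProb Q g b)) - α a * Real.negMulLog (κ a b))
        / Real.log 2 := by
    intro a b
    rw [h, hf, Real.logb, Real.negMulLog]
    rcases (hα a).eq_or_lt with h0 | h0
    · simp [← h0]
    rcases (hκ a b).eq_or_lt with h1 | h1
    · simp [← h1]
    have h2 : 0 < margProb Q g b := by
      rw [hg]
      exact lt_of_lt_of_le (mul_pos h0 h1) (Finset.single_le_sum (f := fun a => α a * κ a b)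
        (fun a _ => mul_nonneg (hα a) (hκ a b)) (Finset.mem_univ a))
    rw [mul_div_mul_left _ _ h0.ne', Real.log_div h1.ne' h2.ne']
    ring
  simp_rw [mutInfo, term, ← Finset.sum_div, Finset.sum_sub_distrib, ← Finset.mul_sum,
    Finset.sum_neg_distrib]
  rw [Finset.sum_comm]
  simp_rw [← Finset.sum_mul, ← hg, Real.negMulLog, neg_mul, Finset.sum_neg_distrib]

end FiniteProbability

section ProductMeasure

/-- Under a product measure, the `i`-th coordinate is independent of everything else. -/
lemma sum_prod_eq_sum_kernel {ι B : Type*} [Fintype ι] [DecidableEq ι] [Fintype B]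
    (W : ι → B → ℝ) (hW : ∀ i, ∑ b, W i b = 1) (i : ι) (ψ : (ι → B) → B → ℝ)
    (hψ : ∀ y c, ψ (Function.update y i c) = ψ y) :
    ∑ y : ι → B, (∏ j, W j (y j)) * ψ y (y i) =
      ∑ y : ι → B, (∏ j, W j (y j)) * ∑ b, W i b * ψ y b := by
  let e := (Equiv.funSplitAt i B).symm
  have hei : ∀ c r, e (c, r) i = c := fun c r => by simp [e, Equiv.funSplitAt, Equiv.piSplitAt]
  have hej : ∀ c r (j : {j // j ≠ i}), e (c, r) j = r j := fun c r j => by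
    simp [e, Equiv.funSplitAt, Equiv.piSplitAt, j.2]
  have hup : ∀ c c' r, e (c, r) = Function.update (e (c', r)) i c := by
    intro c c' r
    funext j
    by_cases hj : j = i
    · subst hj; simp [hei]
    · simp [hj, hej c r ⟨j, hj⟩, hej c' r ⟨j, hj⟩]
  have hc : ∀ c c' r, ψ (e (c, r)) = ψ (e (c', r)) := fun c c' r => by rw [hup c c' r, hψ]
  simp_rw [← e.sum_comp, Fintype.sum_prod_type_right, Fintype.prod_eq_mul_prod_subtype_ne _ i, hei,
    hej]
  refine Finset.sum_congr rfl fun r _ => ?_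
  rcases isEmpty_or_nonempty B with hB | ⟨⟨c₀⟩⟩
  · simp
  simp_rw [fun c => hc c c₀ r]
  rw [← Finset.sum_mul, ← Finset.sum_mul, hW, one_mul, Finset.mul_sum]
  exact Finset.sum_congr rfl fun b _ => by ring

end ProductMeasure

section Code

variable {S X Y Z : Type*} [Fintype S] [Fintype Y] {n : ℕ}
  {PS : S → ℝ} {PYX : X → Y → ℝ} {f : Fin n → (Fin n → S) → X}

lemma inducedP_nonneg (hPS : IsPMF PS) (hPYX : ∀ x, IsPMF (PYX x))
    (ω : (Fin n → S) × (Fin n → Y)) : 0 ≤ inducedP PS PYX f ω :=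
  mul_nonneg (Finset.prod_nonneg fun _ _ => hPS.1 _)
    (Finset.prod_nonneg fun _ _ => (hPYX _).1 _)

/-- Given everything else, the `i`-th channel output has law `PYX (f i s)`. -/
lemma sum_inducedP_channel (hPYX : ∀ x, IsPMF (PYX x)) (i : Fin n)
    (ψ : (Fin n → S) × (Fin n → Y) → Y → ℝ)
    (hψ : ∀ s y c, ψ (s, Function.update y i c) = ψ (s, y)) :
    ∑ ω, inducedP PS PYX f ω * ψ ω (ω.2 i) =
      ∑ ω, inducedP PS PYX f ω * ∑ b, PYX (f i ω.1) b * ψ ω b := by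
  simp_rw [Fintype.sum_prod_type, inducedP, mul_assoc, ← Finset.mul_sum]
  refine Finset.sum_congr rfl fun s _ => ?_
  rw [sum_prod_eq_sum_kernel (fun j => PYX (f j s)) (fun j => (hPYX _).2) i
    (fun y => ψ (s, y)) (hψ s)]

/-- The marginal law of the source sequence. -/
lemma sum_inducedP_source (hPYX : ∀ x, IsPMF (PYX x)) (φ : (Fin n → S) → ℝ) :
    ∑ ω, inducedP PS PYX f ω * φ ω.1 = ∑ s : Fin n → S, (∏ i, PS (s i)) * φ s := by
  classical
  simp_rw [Fintype.sum_prod_type, inducedP]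
  refine Finset.sum_congr rfl fun s _ => ?_
  rw [← Finset.sum_mul, ← Finset.mul_sum, ← Fintype.prod_sum]
  simp [(hPYX _).2]

lemma sum_inducedP (hPS : IsPMF PS) (hPYX : ∀ x, IsPMF (PYX x)) :
    ∑ ω, inducedP PS PYX f ω = 1 := by
  classical
  have h := sum_inducedP_source (PS := PS) (f := f) hPYX 1
  simp only [Pi.one_apply, mul_one] at h
  rw [h, ← Fintype.prod_sum]
  simp [hPS.2]

/-- The `i`-th source letter is independent of the other ones. -/
lemma sum_inducedP_letter (hPS : IsPMF PS) (hPYX : ∀ x, IsPMF (PYX x)) (i : Fin n)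
    (ψ : (Fin n → S) → S → ℝ) (hψ : ∀ s c, ψ (Function.update s i c) = ψ s) :
    ∑ ω, inducedP PS PYX f ω * ψ ω.1 (ω.1 i) =
      ∑ ω, inducedP PS PYX f ω * ∑ b, PS b * ψ ω.1 b := by
  rw [sum_inducedP_source hPYX fun s => ψ s (s i),
    sum_inducedP_source hPYX fun s => ∑ b, PS b * ψ s b]
  exact sum_prod_eq_sum_kernel (fun _ => PS) (fun _ => hPS.2) i ψ hψ

/-- The joint law of an output-independent variable `V` and the `i`-th output. -/
lemma margProb_inducedP_channel {A : Type*} (hPYX : ∀ x, IsPMF (PYX x)) (i : Fin n)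
    (V : (Fin n → S) × (Fin n → Y) → A) (χ : A → X)
    (hV : ∀ s y c, V (s, Function.update y i c) = V (s, y)) (hχ : ∀ ω, χ (V ω) = f i ω.1)
    (a : A) (b : Y) :
    margProb (inducedP PS PYX f) (fun ω => (V ω, ω.2 i)) (a, b) =
      margProb (inducedP PS PYX f) V a * PYX (χ a) b := by
  classical
  have h := sum_inducedP_channel (PS := PS) (f := f) hPYX i
    (fun ω c => if V ω = a ∧ c = b then 1 else 0) (fun s y c => by simp only [hV])
  simp_rw [margProb_eq_sum_ite, Prod.mk.injEq, Finset.sum_mul]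
  simp only [mul_ite, mul_one, mul_zero] at h
  rw [h]
  refine Finset.sum_congr rfl fun ω _ => ?_
  by_cases hω : V ω = a
  · simp [hω, ← hχ]
  · simp [hω]

/-- Replace all letters from position `m` on by the dummy letter `s₀`. -/
def truncateSeq (s₀ : S) (m : ℕ) (s : Fin n → S) : Fin n → S :=
  fun j => if (j : ℕ) < m then s j else s₀

omit [Fintype S] in
lemma truncateSeq_eq_iff (s₀ : S) (m : ℕ) (s s' : Fin n → S) :
    truncateSeq s₀ m s = truncateSeq s₀ m s' ↔ ∀ j : Fin n, (j : ℕ) < m → s j = s' j := by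
  simp only [funext_iff, truncateSeq]
  refine forall_congr' fun j => ?_
  by_cases h : (j : ℕ) < m <;> simp [h]

omit [Fintype S] in
lemma EncOK.apply_truncateSeq (hf : EncOK .strictlyCausal f) (s₀ : S) {i : Fin n} {m : ℕ}
    (hm : (i : ℕ) ≤ m) (s : Fin n → S) : f i (truncateSeq s₀ m s) = f i s := by
  refine hf i _ _ fun j hj => ?_
  have : (j : ℕ) < m := lt_of_lt_of_le hj hm
  simp [truncateSeq, this]

/-- Splitting off the `i`-th output from the entropy of `(Sᵐ, Yⁿ)`, when `i ≤ m`. -/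
lemma entropyOf_truncate_output (hPYX : ∀ x, IsPMF (PYX x)) (hf : EncOK .strictlyCausal f)
    (s₀ : S) (y₀ : Y) (i : Fin n) {m : ℕ} (hm : (i : ℕ) ≤ m) :
    entropyOf (inducedP PS PYX f) (fun ω => (truncateSeq s₀ m ω.1, ω.2)) =
      entropyOf (inducedP PS PYX f)
        (fun ω => (truncateSeq s₀ m ω.1, Function.update ω.2 i y₀)) +
      ∑ ω, inducedP PS PYX f ω * ∑ b, Real.negMulLog (PYX (f i ω.1) b) := by
  rw [entropyOf_congr (g := fun ω => ((truncateSeq s₀ m ω.1, Function.update ω.2 i y₀), ω.2 i))]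
  · rw [entropyOf_prod_of_kernel _ (fun ω : (Fin n → S) × (Fin n → Y) =>
      (truncateSeq s₀ m ω.1, Function.update ω.2 i y₀)) (fun ω => ω.2 i)
      (fun a b => PYX (f i a.1) b) (fun _ => (hPYX _).2)]
    · simp_rw [hf.apply_truncateSeq s₀ hm]
    · exact margProb_inducedP_channel hPYX i
        (fun ω : (Fin n → S) × (Fin n → Y) => (truncateSeq s₀ m ω.1, Function.update ω.2 i y₀))
        (fun a => f i a.1) (fun s y c => by simp) (fun ω => hf.apply_truncateSeq s₀ hm _)
  · intro ω ω'
    simp only [Prod.mk.injEq, and_assoc]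
    refine and_congr_right fun _ => ⟨fun h => by simp [h], fun ⟨h1, h2⟩ => funext fun j => ?_⟩
    by_cases hj : j = i
    · rw [hj, h2]
    · simpa [hj] using congrFun h1 j

/-- The conditional entropies of `Sᵢ` given `(Sⁱ⁻¹, (Yⱼ)_{j ≠ i})` add up to
`H(Sⁿ, Yⁿ) - H(Yⁿ)`. -/
lemma sum_entropyOf_letter (hPYX : ∀ x, IsPMF (PYX x)) (hf : EncOK .strictlyCausal f)
    (s₀ : S) (y₀ : Y) :
    ∑ i : Fin n, (entropyOf (inducedP PS PYX f)
        (fun ω => ((truncateSeq s₀ i ω.1, Function.update ω.2 i y₀), ω.1 i)) -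
      entropyOf (inducedP PS PYX f)
        (fun ω => (truncateSeq s₀ i ω.1, Function.update ω.2 i y₀))) =
      entropyOf (inducedP PS PYX f) id - entropyOf (inducedP PS PYX f) Prod.snd := by
  let H : ℕ → ℝ := fun m => entropyOf (inducedP PS PYX f) fun ω => (truncateSeq s₀ m ω.1, ω.2)
  have hn : H n = entropyOf (inducedP PS PYX f) id :=
    entropyOf_congr _ fun ω ω' => by
      rw [Prod.mk.injEq, truncateSeq_eq_iff]
      simp [Prod.ext_iff, funext_iff]
  have h0 : H 0 = entropyOf (inducedP PS PYX f) Prod.snd :=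
    entropyOf_congr _ fun ω ω' => by simp [truncateSeq_eq_iff]
  rw [← hn, ← h0, ← Finset.sum_range_sub, ← Fin.sum_univ_eq_sum_range (fun m => H (m + 1) - H m)]
  refine Finset.sum_congr rfl fun i _ => ?_
  have h1 : H i = _ := entropyOf_truncate_output (PS := PS) hPYX hf s₀ y₀ i le_rfl
  have h2 : H (i + 1) = _ :=
    entropyOf_truncate_output (PS := PS) hPYX hf s₀ y₀ i (Nat.le_succ _)
  rw [h1, h2, add_sub_add_right_eq_sub]
  congr 1
  refine entropyOf_congr _ fun ω ω' => ?_
  simp only [Prod.mk.injEq, truncateSeq_eq_iff, Nat.lt_succ_iff]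
  constructor
  · rintro ⟨⟨h1, h2⟩, h3⟩
    refine ⟨fun j hj => ?_, h2⟩
    rcases hj.lt_or_eq with h | h
    · exact h1 j h
    · rw [Fin.ext h]; exact h3
  · rintro ⟨h1, h2⟩
    exact ⟨⟨fun j hj => h1 j hj.le, h2⟩, h1 i le_rfl⟩

end Code

section LetterLaw

variable {S X Y Z : Type*} [Fintype S] [Fintype X] [Fintype Y] [Fintype Z] [DecidableEq Y]

/-- `H(S | X, K)` (natural logarithm) for the law `r` of `(X, K, S)`. -/
def condEntropy (r : X × (Y → Z) × S → ℝ) : ℝ :=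
  ∑ x, ∑ k, (∑ s, Real.negMulLog (r (x, k, s)) - Real.negMulLog (∑ s, r (x, k, s)))

/-- The law of the channel output when `(X, K, S)` has law `r`. -/
def outputLaw (PYX : X → Y → ℝ) (r : X × (Y → Z) × S → ℝ) (y : Y) : ℝ :=
  ∑ t, r t * PYX t.1 y

open Classical in
/-- The law of `(S, X, Y, K Y)` when `(X, K, S)` has law `r` and `Y` is the channel output. -/
def jointLaw (PYX : X → Y → ℝ) (r : X × (Y → Z) × S → ℝ) (a : S × X × Y × Z) : ℝ :=
  PYX a.2.1 a.2.2.1 * ∑ k : Y → Z, if k a.2.2.1 = a.2.2.2 then r (a.2.1, k, a.1) else 0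

/-- Laws of `(X, K, S)` with `X` independent of `S ∼ PS` which satisfy
`I(X, K; S) ≤ I(X, K; Y)`, the latter being expressed through entropies. -/
def admissibleLaws (PS : S → ℝ) (PYX : X → Y → ℝ) : Set (X × (Y → Z) × S → ℝ) :=
  {r | r ∈ stdSimplex ℝ (X × (Y → Z) × S) ∧
    (∀ x s, ∑ k, r (x, k, s) = PS s * ∑ k, ∑ s', r (x, k, s')) ∧
    ∑ t, r t * (∑ y, Real.negMulLog (PYX t.1 y) - Real.log (PS t.2.2)) ≤
      condEntropy r + ∑ y, Real.negMulLog (outputLaw PYX r y)}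

lemma isCompact_admissibleLaws (PS : S → ℝ) (PYX : X → Y → ℝ) :
    IsCompact (admissibleLaws PS PYX : Set (X × (Y → Z) × S → ℝ)) := by
  have h1 : IsClosed {r : X × (Y → Z) × S → ℝ |
      ∀ x s, ∑ k, r (x, k, s) = PS s * ∑ k, ∑ s', r (x, k, s')} := by
    simp only [Set.ofPred_forall]
    exact isClosed_iInter fun x => isClosed_iInter fun s =>
      isClosed_eq (by fun_prop) (by fun_prop)
  have h2 : IsClosed {r : X × (Y → Z) × S → ℝ |
      ∑ t, r t * (∑ y, Real.negMulLog (PYX t.1 y) - Real.log (PS t.2.2)) ≤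
        condEntropy r + ∑ y, Real.negMulLog (outputLaw PYX r y)} := by
    refine isClosed_le (by fun_prop) ?_
    unfold condEntropy outputLaw
    fun_prop
  exact (isCompact_stdSimplex ℝ (X × (Y → Z) × S)).inter_right (h1.inter h2)

omit [Fintype S] [Fintype X] in
lemma continuous_jointLaw (PYX : X → Y → ℝ) :
    Continuous (jointLaw PYX : (X × (Y → Z) × S → ℝ) → S × X × Y × Z → ℝ) := by
  refine continuous_pi fun a => continuous_const.mul (continuous_finsetSum _ fun k _ => ?_)
  split_ifs <;> fun_prop

variable {n : ℕ} {PS : S → ℝ} {PYX : X → Y → ℝ} {f : Fin n → (Fin n → S) → X}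
  {g : Fin n → (Fin n → Y) → Z}

/-- Channel input, reconstruction as a function of the current output, and source letter
at time `i`. -/
def letterAt (f : Fin n → (Fin n → S) → X) (g : Fin n → (Fin n → Y) → Z) (i : Fin n)
    (ω : (Fin n → S) × (Fin n → Y)) : X × (Y → Z) × S :=
  (f i ω.1, fun y => g i (Function.update ω.2 i y), ω.1 i)

/-- Time-averaged law of `letterAt`. -/
def letterLaw (PS : S → ℝ) (PYX : X → Y → ℝ) (f : Fin n → (Fin n → S) → X)
    (g : Fin n → (Fin n → Y) → Z) (t : X × (Y → Z) × S) : ℝ :=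
  (∑ i, margProb (inducedP PS PYX f) (letterAt f g i) t) / n

lemma sum_letterLaw_mul (ψ : X × (Y → Z) × S → ℝ) :
    ∑ t, letterLaw PS PYX f g t * ψ t =
      (∑ i, ∑ ω, inducedP PS PYX f ω * ψ (letterAt f g i ω)) / n := by
  simp_rw [fun i => (sum_margProb_mul (inducedP PS PYX f) (letterAt f g i) ψ).symm, letterLaw,
    div_mul_eq_mul_div, ← Finset.sum_div, Finset.sum_mul]
  rw [Finset.sum_comm]

omit [Fintype X] [Fintype Z] [DecidableEq Y] in
lemma letterLaw_nonneg (hPS : IsPMF PS) (hPYX : ∀ x, IsPMF (PYX x)) (t : X × (Y → Z) × S) :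
    0 ≤ letterLaw PS PYX f g t :=
  div_nonneg (Finset.sum_nonneg fun _ _ => margProb_nonneg (inducedP_nonneg hPS hPYX) _ _)
    n.cast_nonneg

omit [Fintype X] [Fintype Z] [DecidableEq Y] in
lemma margProb_letterAt_le (hPS : IsPMF PS) (hPYX : ∀ x, IsPMF (PYX x)) (hn : 0 < n) (i : Fin n)
    (t : X × (Y → Z) × S) :
    margProb (inducedP PS PYX f) (letterAt f g i) t ≤ n * letterLaw PS PYX f g t := by
  rw [letterLaw, mul_div_cancel₀ _ (by positivity)]
  exact Finset.single_le_sum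
    (f := fun i => margProb (inducedP PS PYX f) (letterAt f g i) t)
    (fun _ _ => margProb_nonneg (inducedP_nonneg hPS hPYX) _ _) (Finset.mem_univ i)

lemma letterLaw_mem_stdSimplex (hPS : IsPMF PS) (hPYX : ∀ x, IsPMF (PYX x)) (hn : 0 < n) :
    letterLaw PS PYX f g ∈ stdSimplex ℝ (X × (Y → Z) × S) := by
  refine ⟨letterLaw_nonneg hPS hPYX, ?_⟩
  have h := sum_letterLaw_mul (PS := PS) (PYX := PYX) (f := f) (g := g) 1
  simp only [Pi.one_apply, mul_one, sum_inducedP hPS hPYX] at h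
  rw [h]
  have : (n : ℝ) ≠ 0 := by positivity
  simp [this]

lemma letterLaw_indep (hPS : IsPMF PS) (hPYX : ∀ x, IsPMF (PYX x))
    (hf : EncOK .strictlyCausal f) (x : X) (s : S) :
    ∑ k, letterLaw PS PYX f g (x, k, s) = PS s * ∑ k, ∑ s', letterLaw PS PYX f g (x, k, s') := by
  classical
  have h1 := sum_letterLaw_mul (PS := PS) (PYX := PYX) (f := f) (g := g)
    fun t => (if t.1 = x then 1 else 0) * if t.2.2 = s then 1 else 0
  have h2 := sum_letterLaw_mul (PS := PS) (PYX := PYX) (f := f) (g := g)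
    fun t => if t.1 = x then 1 else 0
  rw [Fintype.sum_prod_type, Finset.sum_eq_single x (by simp +contextual) (by simp),
    Fintype.sum_prod_type] at h1 h2
  simp only [if_true, mul_ite, mul_one, mul_zero, Finset.sum_ite_eq', Finset.mem_univ]
    at h1 h2
  rw [h1, h2, mul_div_assoc', Finset.mul_sum]
  congr 1
  refine Finset.sum_congr rfl fun i _ => ?_
  have h3 := sum_inducedP_letter (f := f) hPS hPYX i
    (fun u c => (if f i u = x then 1 else 0) * if c = s then 1 else 0) (fun u c => by
      rw [hf i (Function.update u i c) u fun j hj => by simp [hj.ne]])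
  simp only [mul_ite, mul_one, mul_zero, Finset.sum_ite_eq', Finset.mem_univ, if_true] at h3
  refine h3.trans ?_
  rw [Finset.mul_sum]
  simp only [mul_comm (PS s), ite_mul, zero_mul]
  rfl

lemma outputLaw_letterLaw_mul (hPYX : ∀ x, IsPMF (PYX x)) (ψ : Y → ℝ) :
    ∑ y, outputLaw PYX (letterLaw PS PYX f g) y * ψ y =
      (∑ i, ∑ ω, inducedP PS PYX f ω * ψ (ω.2 i)) / n := by
  simp_rw [outputLaw, Finset.sum_mul]
  rw [Finset.sum_comm]
  simp_rw [mul_assoc, ← Finset.mul_sum]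
  rw [sum_letterLaw_mul fun t => ∑ y, PYX t.1 y * ψ y]
  congr 1
  refine Finset.sum_congr rfl fun i _ => ?_
  rw [sum_inducedP_channel hPYX i (fun _ => ψ) (fun _ _ _ => rfl)]
  rfl

lemma outputLaw_nonneg (hPYX : ∀ x, IsPMF (PYX x)) {r : X × (Y → Z) × S → ℝ}
    (hr : ∀ t, 0 ≤ r t) (y : Y) : 0 ≤ outputLaw PYX r y :=
  Finset.sum_nonneg fun t _ => mul_nonneg (hr t) ((hPYX _).1 y)

lemma sum_outputLaw (hPYX : ∀ x, IsPMF (PYX x)) {r : X × (Y → Z) × S → ℝ}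
    (hr : ∑ t, r t = 1) : ∑ y, outputLaw PYX r y = 1 := by
  simp_rw [outputLaw]
  rw [Finset.sum_comm]
  simp_rw [← Finset.mul_sum, (hPYX _).2, mul_one, hr]

/-- The joint law synthesized from `letterLaw` is the time-averaged law of
`(Sᵢ, Xᵢ, Yᵢ, Ŝᵢ)`. -/
lemma jointLaw_letterLaw (hPYX : ∀ x, IsPMF (PYX x)) (a : S × X × Y × Z) :
    jointLaw PYX (letterLaw PS PYX f g) a =
      (∑ i, margProb (inducedP PS PYX f)
        (fun ω => (ω.1 i, f i ω.1, ω.2 i, g i ω.2)) a) / n := by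
  classical
  obtain ⟨s, x, y, z⟩ := a
  have h1 := sum_letterLaw_mul (PS := PS) (PYX := PYX) (f := f) (g := g)
    fun t => if t.1 = x then if t.2.1 y = z then if t.2.2 = s then PYX x y else 0 else 0 else 0
  rw [Fintype.sum_prod_type, Finset.sum_eq_single x (by simp +contextual) (by simp),
    Fintype.sum_prod_type] at h1
  simp only [mul_ite, mul_zero, Finset.sum_ite_irrel,
    Finset.sum_const_zero, Finset.sum_ite_eq', Finset.mem_univ, if_true] at h1
  simp only [jointLaw]
  rw [mul_comm, Finset.sum_mul]
  simp only [ite_mul, zero_mul]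
  rw [h1]
  congr 1
  refine Finset.sum_congr rfl fun i _ => ?_
  have h3 := sum_inducedP_channel (PS := PS) (f := f) hPYX i
    (fun ω b => if f i ω.1 = x then if g i (Function.update ω.2 i y) = z then
      if ω.1 i = s then if b = y then 1 else 0 else 0 else 0 else 0) (fun u v c => by simp)
  simp only [mul_ite, mul_one, mul_zero, Finset.sum_ite_irrel,
    Finset.sum_const_zero, Finset.sum_ite_eq', Finset.mem_univ, if_true] at h3
  refine Eq.trans ?_ (Eq.trans h3.symm ?_)
  · refine Finset.sum_congr rfl fun ω _ => ?_
    by_cases hx : f i ω.1 = x <;> simp [letterAt, hx]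
  · rw [margProb_eq_sum_ite]
    refine Finset.sum_congr rfl fun ω _ => ?_
    by_cases hy : ω.2 i = y
    · rw [← hy, Function.update_eq_self]
      by_cases h1 : f i ω.1 = x <;> by_cases h2 : g i ω.2 = z <;> by_cases h3 : ω.1 i = s <;>
        simp [h1, h2, h3]
    · simp [hy]

/-- The entropy of the source and output sequences in single-letter form. -/
lemma entropyOf_inducedP_id (hPYX : ∀ x, IsPMF (PYX x)) (hn : 0 < n) :
    entropyOf (inducedP PS PYX f) id =
      n * ∑ t, letterLaw PS PYX f g t *
        (∑ y, Real.negMulLog (PYX t.1 y) - Real.log (PS t.2.2)) := by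
  classical
  rw [sum_letterLaw_mul, mul_div_cancel₀ _ (by positivity)]
  have h1 : ∀ ω, inducedP PS PYX f ω * Real.log (inducedP PS PYX f ω) =
      ∑ i, (inducedP PS PYX f ω * Real.log (PS (ω.1 i)) +
        inducedP PS PYX f ω * Real.log (PYX (f i ω.1) (ω.2 i))) := by
    intro ω
    by_cases h0 : inducedP PS PYX f ω = 0
    · simp [h0]
    · have ha := left_ne_zero_of_mul h0
      have hb := right_ne_zero_of_mul h0
      rw [Finset.sum_add_distrib, ← Finset.mul_sum, ← Finset.mul_sum, ← mul_add,
        ← Real.log_prod (by simpa [Finset.prod_eq_zero_iff] using ha),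
        ← Real.log_prod (by simpa [Finset.prod_eq_zero_iff] using hb), ← Real.log_mul ha hb]
      rfl
  have h2 : ∀ ω, margProb (inducedP PS PYX f) id ω = inducedP PS PYX f ω := fun ω =>
    (margProb_eq_sum_ite _ _ _).trans
      ((Finset.sum_eq_single ω (fun ω' _ h => if_neg h) (by simp)).trans (if_pos rfl))
  rw [entropyOf_eq_sum]
  simp only [h2, id]
  simp_rw [h1]
  rw [Finset.sum_comm, ← Finset.sum_neg_distrib]
  refine Finset.sum_congr rfl fun i _ => ?_
  rw [Finset.sum_add_distrib, sum_inducedP_channel hPYX i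
    (fun ω b => Real.log (PYX (f i ω.1) b)) (fun _ _ _ => rfl)]
  simp only [letterAt, mul_sub, Finset.sum_sub_distrib, Real.negMulLog, neg_mul,
    Finset.sum_neg_distrib, mul_neg]
  ring

/-- Subadditivity and concavity of entropy for the output sequence. -/
lemma entropyOf_inducedP_output_le (hPS : IsPMF PS) (hPYX : ∀ x, IsPMF (PYX x)) (hn : 0 < n) :
    entropyOf (inducedP PS PYX f) Prod.snd ≤
      n * ∑ y, Real.negMulLog (outputLaw PYX (letterLaw PS PYX f g) y) := by
  classical
  set p := outputLaw PYX (letterLaw PS PYX f g) with hp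
  have hp0 : ∀ y, 0 ≤ p y := outputLaw_nonneg hPYX (letterLaw_nonneg hPS hPYX)
  have hp1 : ∑ y, p y = 1 := sum_outputLaw hPYX (letterLaw_mem_stdSimplex hPS hPYX hn).2
  have hP0 : ∀ ω, 0 ≤ inducedP PS PYX f ω := inducedP_nonneg hPS hPYX
  have hac : ∀ ω i, p (ω.2 i) = 0 → inducedP PS PYX f ω = 0 := by
    intro ω i h0
    have h := outputLaw_letterLaw_mul (PS := PS) (f := f) (g := g) hPYX
      fun y => if y = ω.2 i then 1 else 0
    simp only [mul_ite, mul_one, mul_zero, Finset.sum_ite_eq', Finset.mem_univ, if_true,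
      ← hp, h0] at h
    have hnn : (n : ℝ) ≠ 0 := by positivity
    rw [eq_comm, div_eq_zero_iff, or_iff_left hnn] at h
    have hnonneg : ∀ (j : Fin n) ω', 0 ≤ if ω'.2 j = ω.2 i then inducedP PS PYX f ω' else 0 :=
      fun j ω' => by split_ifs <;> simp [hP0]
    rw [Finset.sum_eq_zero_iff_of_nonneg fun j _ => Finset.sum_nonneg fun ω' _ => hnonneg j ω'] at h
    have h' := h i (Finset.mem_univ i)
    rw [Finset.sum_eq_zero_iff_of_nonneg fun ω' _ => hnonneg i ω'] at h'
    simpa using h' ω (Finset.mem_univ ω)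
  have hgibbs := sum_negMulLog_sub_le (u := margProb (inducedP PS PYX f) Prod.snd)
    (q := fun y : Fin n → Y => ∏ i, p (y i)) (margProb_nonneg hP0 _)
    (fun y => Finset.prod_nonneg fun _ _ => hp0 _)
    (by rw [← Fintype.prod_sum]; simp [hp1]) (fun y hy => by
      obtain ⟨i, -, hi⟩ := Finset.prod_eq_zero_iff.1 hy
      rw [margProb_eq_sum_ite]
      refine Finset.sum_eq_zero fun ω _ => ?_
      split_ifs with h
      · exact hac ω i (by rw [h, hi])
      · rfl)
  rw [sum_margProb, sum_inducedP hPS hPYX, Real.negMulLog_one, sub_zero,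
    sum_margProb_mul _ _ fun y : Fin n → Y => Real.log (∏ i, p (y i))] at hgibbs
  refine hgibbs.trans (le_of_eq ?_)
  have hlog : ∀ ω, inducedP PS PYX f ω * Real.log (∏ i, p (ω.2 i)) =
      ∑ i, inducedP PS PYX f ω * Real.log (p (ω.2 i)) := by
    intro ω
    by_cases h0 : inducedP PS PYX f ω = 0
    · simp [h0]
    · rw [Real.log_prod fun i _ hi => h0 (hac ω i hi), Finset.mul_sum]
  simp_rw [hlog, Real.negMulLog, neg_mul, Finset.sum_neg_distrib]
  rw [outputLaw_letterLaw_mul hPYX fun y => Real.log (p y), Finset.sum_comm]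
  field_simp

/-- Conditioning on `(X, K)` instead of the whole past and the other outputs does not decrease
the entropy of the source letter. -/
lemma entropyOf_sub_le_condEntropy (hPS : IsPMF PS) (hPYX : ∀ x, IsPMF (PYX x)) (hn : 0 < n)
    (hf : EncOK .strictlyCausal f) :
    entropyOf (inducedP PS PYX f) id - entropyOf (inducedP PS PYX f) Prod.snd ≤
      n * condEntropy (letterLaw PS PYX f g) := by
  classical
  set r := letterLaw PS PYX f g with hr
  have hP0 : ∀ ω, 0 ≤ inducedP PS PYX f ω := inducedP_nonneg hPS hPYX
  have hr0 : ∀ t, 0 ≤ r t := letterLaw_nonneg hPS hPYX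
  have hΩ : Nonempty ((Fin n → S) × (Fin n → Y)) := by
    by_contra h
    rw [not_nonempty_iff] at h
    simpa using sum_inducedP (f := f) hPS hPYX
  obtain ⟨ω₀⟩ := hΩ
  let q : X × (Y → Z) × S → ℝ := fun t => r t / ∑ s, r (t.1, t.2.1, s)
  have hsum0 : ∀ x k, 0 ≤ ∑ s, r (x, k, s) := fun x k => Finset.sum_nonneg fun s _ => hr0 _
  have hc : n * condEntropy r =
      ∑ i, -∑ ω, inducedP PS PYX f ω * Real.log (q (letterAt f g i ω)) := by
    have h1 : condEntropy r = -∑ t, r t * Real.log (q t) := by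
      simp_rw [condEntropy, Fintype.sum_prod_type, ← Finset.sum_neg_distrib (s := Finset.univ)]
      refine Finset.sum_congr rfl fun x _ => Finset.sum_congr rfl fun k _ => ?_
      rw [sum_negMulLog_sub_eq fun s => hr0 _, Finset.sum_neg_distrib]
    rw [h1, hr, sum_letterLaw_mul, Finset.sum_neg_distrib, mul_neg,
      mul_div_cancel₀ _ (by positivity)]
  rw [hc, ← sum_entropyOf_letter hPYX hf (ω₀.1 ⟨0, hn⟩) (ω₀.2 ⟨0, hn⟩)]
  refine Finset.sum_le_sum fun i _ => ?_
  set V : (Fin n → S) × (Fin n → Y) → (Fin n → S) × (Fin n → Y) := fun ω =>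
    (truncateSeq (ω₀.1 ⟨0, hn⟩) i ω.1, Function.update ω.2 i (ω₀.2 ⟨0, hn⟩)) with hV
  let T : ((Fin n → S) × (Fin n → Y)) × S → X × (Y → Z) × S := fun a =>
    (f i a.1.1, fun y => g i (Function.update a.1.2 i y), a.2)
  have hT : ∀ ω, letterAt f g i ω = T (V ω, ω.1 i) := fun ω => by
    simp [letterAt, T, hV, hf.apply_truncateSeq _ le_rfl]
  simp_rw [hT]
  rw [← sum_margProb_mul _ (fun ω : (Fin n → S) × (Fin n → Y) => (V ω, ω.1 i))
    fun a => Real.log (q (T a)), Fintype.sum_prod_type, entropyOf, entropyOf,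
    Fintype.sum_prod_type, ← Finset.sum_sub_distrib, ← Finset.sum_neg_distrib]
  refine Finset.sum_le_sum fun a _ => ?_
  rw [← sum_margProb_prod (inducedP PS PYX f) V (fun ω => ω.1 i) a]
  refine sum_negMulLog_sub_le (fun s => margProb_nonneg hP0 _ _)
    (fun s => div_nonneg (hr0 _) (hsum0 _ _)) ?_ fun s hs => ?_
  · simp only [q, T, ← Finset.sum_div]
    exact div_self_le_one _
  · have h0 : r (T (a, s)) = 0 := by
      rcases div_eq_zero_iff.1 hs with h | h
      · exact h
      · exact (Finset.sum_eq_zero_iff_of_nonneg fun s _ => hr0 _).1 h s (Finset.mem_univ s)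
    have h1 := margProb_letterAt_le (f := f) (g := g) hPS hPYX hn i (T (a, s))
    rw [← hr, h0, mul_zero] at h1
    refine le_antisymm (le_trans ?_ h1) (margProb_nonneg hP0 _ _)
    simp_rw [margProb_eq_sum_ite]
    refine Finset.sum_le_sum fun ω _ => ?_
    by_cases h : (V ω, ω.1 i) = (a, s)
    · rw [hT, h, if_pos rfl, if_pos rfl]
    · rw [if_neg h]
      split_ifs <;> simp [hP0]

lemma letterLaw_mem_admissibleLaws (hPS : IsPMF PS) (hPYX : ∀ x, IsPMF (PYX x)) (hn : 0 < n)
    (hf : EncOK .strictlyCausal f) : letterLaw PS PYX f g ∈ admissibleLaws PS PYX := by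
  refine ⟨letterLaw_mem_stdSimplex hPS hPYX hn, letterLaw_indep hPS hPYX hf, ?_⟩
  have h1 := entropyOf_inducedP_id (PS := PS) (f := f) (g := g) hPYX hn
  have h2 := entropyOf_inducedP_output_le (f := f) (g := g) hPS hPYX hn
  have h3 := entropyOf_sub_le_condEntropy (g := g) hPS hPYX hn hf
  have hn' : (0 : ℝ) < n := by positivity
  refine le_of_mul_le_mul_left ?_ hn'
  rw [← h1, mul_add]
  linarith

end LetterLaw

section SingleLetter

variable {S X Y Z : Type} [Fintype S] [Fintype X] [Fintype Y] [Fintype Z] [DecidableEq Y]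
  {PS : S → ℝ} {PYX : X → Y → ℝ}

open Classical in
/-- An admissible law of `(X, K, S)` gives the auxiliary variable `V = K` of the single-letter
characterization. -/
lemma exists_auxiliary_of_mem_admissibleLaws (hPS : IsPMF PS) (hPYX : ∀ x, IsPMF (PYX x))
    {r : X × (Y → Z) × S → ℝ} (hr : r ∈ admissibleLaws PS PYX) :
    ∃ (m : ℕ) (PX : X → ℝ) (PVgXS : X → S → Fin m → ℝ)
      (PZgVY : Fin m → Y → Z → ℝ) (Q : S × X × Y × Z × Fin m → ℝ),
      IsPMF PX ∧
      (∀ x s, IsPMF (PVgXS x s)) ∧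
      (∀ v y, IsPMF (PZgVY v y)) ∧
      (∀ s x y z v,
        Q (s, x, y, z, v) = PS s * PX x * PVgXS x s v * PYX x y * PZgVY v y z) ∧
      (∀ s x y z, jointLaw PYX r (s, x, y, z) = ∑ v, Q (s, x, y, z, v)) ∧
      mutInfo Q (fun ω => (ω.2.1, ω.2.2.2.2)) (fun ω => ω.1)
        ≤ mutInfo Q (fun ω => (ω.2.1, ω.2.2.2.2)) (fun ω => ω.2.2.1) := by
  obtain ⟨⟨hr0, hr1⟩, hind, hent⟩ := hr
  have hK : Nonempty (Y → Z) := by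
    by_contra h
    rw [not_nonempty_iff] at h
    simp at hr1
  let e := (Fintype.equivFin (Y → Z)).symm
  have hm : Nonempty (Fin (Fintype.card (Y → Z))) := ⟨e.symm hK.some⟩
  obtain ⟨v₀⟩ := hm
  let PX : X → ℝ := fun x => ∑ k, ∑ s, r (x, k, s)
  let w : X × Fin (Fintype.card (Y → Z)) → ℝ := fun a => ∑ s, r (a.1, e a.2, s)
  have hPX0 : ∀ x, 0 ≤ PX x := fun x =>
    Finset.sum_nonneg fun k _ => Finset.sum_nonneg fun s _ => hr0 _
  have hPX1 : ∑ x, PX x = 1 := by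
    rw [← hr1]
    simp only [PX, Fintype.sum_prod_type]
  have hw0 : ∀ a, 0 ≤ w a := fun a => Finset.sum_nonneg fun s _ => hr0 _
  have hind' : ∀ x s, ∑ v, r (x, e v, s) = PS s * PX x := fun x s => by
    rw [e.sum_comp fun k => r (x, k, s), hind]
  have hrz : ∀ x s v, PS s * PX x = 0 → r (x, e v, s) = 0 := fun x s v h =>
    (Finset.sum_eq_zero_iff_of_nonneg fun v _ => hr0 _).1 ((hind' x s).trans h) v
      (Finset.mem_univ v)
  have hwz : ∀ a s, w a = 0 → r (a.1, e a.2, s) = 0 := fun a s h =>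
    (Finset.sum_eq_zero_iff_of_nonneg fun s _ => hr0 _).1 h s (Finset.mem_univ s)
  let PV : X → S → Fin (Fintype.card (Y → Z)) → ℝ := fun x s v =>
    if PS s * PX x = 0 then (if v = v₀ then 1 else 0) else r (x, e v, s) / (PS s * PX x)
  let PZ : Fin (Fintype.card (Y → Z)) → Y → Z → ℝ := fun v y z => if e v y = z then 1 else 0
  have hPV : ∀ x s v, PS s * PX x * PV x s v = r (x, e v, s) := by
    intro x s v
    by_cases h : PS s * PX x = 0
    · rw [hrz x s v h, h, zero_mul]
    · simp only [PV, if_neg h]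
      exact mul_div_cancel₀ _ h
  let Q : S × X × Y × Z × Fin (Fintype.card (Y → Z)) → ℝ := fun ω =>
    r (ω.2.1, e ω.2.2.2.2, ω.1) * PYX ω.2.1 ω.2.2.1 * PZ ω.2.2.2.2 ω.2.2.1 ω.2.2.2.1
  have hPZ : ∀ v y, ∑ z, PZ v y z = 1 := fun v y => by simp [PZ]
  have hQ : ∀ ψ : S → X → Y → Fin (Fintype.card (Y → Z)) → ℝ,
      ∑ ω, Q ω * ψ ω.1 ω.2.1 ω.2.2.1 ω.2.2.2.2 =
        ∑ s, ∑ x, ∑ v, r (x, e v, s) * ∑ y, PYX x y * ψ s x y v := by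
    intro ψ
    simp only [Q, Fintype.sum_prod_type]
    refine Finset.sum_congr rfl fun s _ => Finset.sum_congr rfl fun x _ => ?_
    simp_rw [Finset.mul_sum]
    refine Eq.trans (Finset.sum_congr rfl fun y _ => ?_) Finset.sum_comm
    rw [Finset.sum_comm]
    refine Finset.sum_congr rfl fun v _ => ?_
    refine Eq.trans (Finset.sum_congr rfl fun z _ => mul_right_comm _ _ _) ?_
    rw [← Finset.mul_sum, hPZ, mul_one, mul_assoc]
  have hmarg : ∀ {A : Type} [Fintype A] (h : S → X → Y → Fin (Fintype.card (Y → Z)) → A) (a : A),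
      margProb Q (fun ω => h ω.1 ω.2.1 ω.2.2.1 ω.2.2.2.2) a =
        ∑ s, ∑ x, ∑ v, r (x, e v, s) * ∑ y, PYX x y * if h s x y v = a then 1 else 0 := by
    intro A _ h a
    rw [← hQ fun s x y v => if h s x y v = a then 1 else 0, margProb_eq_sum_ite]
    simp
  have hmS : ∀ a s, margProb Q (fun ω => ((ω.2.1, ω.2.2.2.2), ω.1)) (a, s) =
      r (a.1, e a.2, s) := by
    intro a s
    have h := hmarg (fun s x _ v => ((x, v), s)) (a, s)
    refine h.trans ?_
    rw [Finset.sum_eq_single s (by simp +contextual) (by simp),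
      Finset.sum_eq_single a.1 (by simp +contextual [Prod.ext_iff]) (by simp),
      Finset.sum_eq_single a.2 (by simp +contextual [Prod.ext_iff]) (by simp)]
    simp [(hPYX _).2]
  have hmY : ∀ a y, margProb Q (fun ω => ((ω.2.1, ω.2.2.2.2), ω.2.2.1)) (a, y) =
      w a * PYX a.1 y := by
    intro a y
    have h := hmarg (fun _ x y v => ((x, v), y)) (a, y)
    refine h.trans ?_
    simp only [w, Finset.sum_mul]
    refine Finset.sum_congr rfl fun s _ => ?_
    rw [Finset.sum_eq_single a.1 (by simp +contextual [Prod.ext_iff]) (by simp),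
      Finset.sum_eq_single a.2 (by simp +contextual [Prod.ext_iff]) (by simp),
      Finset.sum_eq_single y (by simp +contextual [Prod.ext_iff]) (by simp)]
    simp
  have hS : ∀ s, margProb Q (fun ω => ω.1) s = PS s := by
    intro s
    refine (hmarg (fun s _ _ _ => s) s).trans ?_
    rw [Finset.sum_eq_single s (by simp +contextual) (by simp)]
    simp [(hPYX _).2, hind', ← Finset.mul_sum, hPX1]
  have hY : ∀ y, margProb Q (fun ω => ω.2.2.1) y = outputLaw PYX r y := by
    intro y
    refine (hmarg (fun _ _ y _ => y) y).trans ?_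
    simp only [outputLaw, Fintype.sum_prod_type]
    rw [Finset.sum_comm]
    refine Finset.sum_congr rfl fun x _ => ?_
    rw [Finset.sum_comm, ← e.sum_comp]
    refine Finset.sum_congr rfl fun v _ => Finset.sum_congr rfl fun s _ => ?_
    rw [Finset.sum_eq_single y (by simp +contextual) (by simp)]
    simp
  have hwsum : ∀ ψ : X → ℝ, ∑ t, r t * ψ t.1 = ∑ a, w a * ψ a.1 := by
    intro ψ
    simp only [w, Fintype.sum_prod_type, Finset.sum_mul]
    refine Finset.sum_congr rfl fun x _ => ?_
    rw [← e.sum_comp]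
  let κ : X × Fin (Fintype.card (Y → Z)) → S → ℝ := fun a s =>
    if w a = 0 then PS s else r (a.1, e a.2, s) / w a
  have hκ : ∀ a s, w a * κ a s = r (a.1, e a.2, s) := by
    intro a s
    by_cases h : w a = 0
    · rw [hwz a s h, h, zero_mul]
    · simp only [κ, if_neg h]
      exact mul_div_cancel₀ _ h
  have hκ0 : ∀ a s, 0 ≤ κ a s := by
    intro a s
    simp only [κ]
    split_ifs
    · exact hPS.1 s
    · exact div_nonneg (hr0 _) (hw0 _)
  have hκ1 : ∀ a, ∑ s, κ a s = 1 := by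
    intro a
    simp only [κ]
    split_ifs with h
    · exact hPS.2
    · rw [← Finset.sum_div]
      exact div_self h
  have hcond : ∑ a, w a * ∑ s, Real.negMulLog (κ a s) = condEntropy r := by
    rw [condEntropy, Fintype.sum_prod_type]
    refine Finset.sum_congr rfl fun x _ => ?_
    rw [← e.sum_comp]
    refine Finset.sum_congr rfl fun v _ => ?_
    have h : ∀ s, Real.negMulLog (r (x, e v, s)) =
        κ (x, v) s * Real.negMulLog (w (x, v)) + w (x, v) * Real.negMulLog (κ (x, v) s) :=
      fun s => by rw [← hκ (x, v) s, Real.negMulLog_mul]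
    simp_rw [h, Finset.sum_add_distrib, ← Finset.sum_mul, ← Finset.mul_sum, hκ1, one_mul, w]
    ring
  have hlogS : ∑ t, r t * Real.log (PS t.2.2) = -∑ s, Real.negMulLog (PS s) := by
    have h : ∑ t, r t * Real.log (PS t.2.2) = ∑ s, PS s * Real.log (PS s) * ∑ x, PX x := by
      simp only [Fintype.sum_prod_type, Finset.mul_sum]
      rw [Finset.sum_comm (γ := S)]
      refine Finset.sum_congr rfl fun x _ => ?_
      rw [Finset.sum_comm]
      refine Finset.sum_congr rfl fun s _ => ?_
      rw [← Finset.sum_mul, hind]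
      ring
    simp only [h, hPX1, Real.negMulLog, neg_mul, Finset.sum_neg_distrib, neg_neg, mul_one]
  refine ⟨Fintype.card (Y → Z), PX, PV, PZ, Q, ⟨hPX0, hPX1⟩, fun x s => ?_,
    fun v y => ⟨fun z => ?_, hPZ v y⟩, fun s x y z v => ?_, fun s x y z => ?_, ?_⟩
  · by_cases h : PS s * PX x = 0
    · simp only [PV, if_pos h]
      exact ⟨fun v => by beta_reduce; split_ifs <;> norm_num, by simp⟩
    · simp only [PV, if_neg h]
      refine ⟨fun v => div_nonneg (hr0 _) (mul_nonneg (hPS.1 s) (hPX0 x)), ?_⟩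
      rw [← Finset.sum_div, hind', div_self h]
  · simp only [PZ]
    split_ifs <;> norm_num
  · rw [hPV]
  · simp only [jointLaw, Q, PZ]
    rw [← e.sum_comp, Finset.mul_sum]
    refine Finset.sum_congr rfl fun v _ => ?_
    split_ifs <;> simp [mul_comm]
  · rw [mutInfo_of_kernel Q (fun ω => (ω.2.1, ω.2.2.2.2)) (fun ω => ω.1) w κ hw0 hκ0 hκ1
        fun a s => (hmS a s).trans (hκ a s).symm,
      mutInfo_of_kernel Q (fun ω => (ω.2.1, ω.2.2.2.2)) (fun ω => ω.2.2.1) w (fun a => PYX a.1)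
        hw0 (fun a => (hPYX _).1) (fun a => (hPYX _).2) hmY]
    refine div_le_div_of_nonneg_right ?_ (Real.log_nonneg one_le_two)
    simp_rw [mul_sub, Finset.sum_sub_distrib] at hent
    rw [hlogS, hwsum fun x => ∑ y, Real.negMulLog (PYX x y)] at hent
    simp_rw [hS, hY, hcond]
    linarith

end SingleLetter

section Approximation

variable {Ω A : Type*} [Fintype Ω]

lemma empDist_nonneg {n : ℕ} (w : Fin n → A) (a : A) : 0 ≤ empDist w a :=
  div_nonneg (Finset.sum_nonneg fun _ _ => Set.indicator_nonneg (fun _ _ => zero_le_one) _)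
    n.cast_nonneg

lemma empDist_le_one {n : ℕ} (w : Fin n → A) (a : A) : empDist w a ≤ 1 := by
  refine div_le_one_of_le₀ ?_ n.cast_nonneg
  refine (Finset.sum_le_card_nsmul _ _ 1 fun i _ =>
    Set.indicator_le_self' (fun _ _ => zero_le_one) i).trans (by simp)

/-- The mean of the empirical distribution is the time average of the marginal laws. -/
lemma sum_mul_empDist {n : ℕ} (P : Ω → ℝ) (W : Ω → Fin n → A) (a : A) :
    ∑ ω, P ω * empDist (W ω) a = (∑ i, margProb P (fun ω => W ω i) a) / n := by
  classical
  simp_rw [empDist, mul_div_assoc', ← Finset.sum_div, Finset.mul_sum, margProb_eq_sum_ite]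
  rw [Finset.sum_comm]
  simp [Set.indicator_apply]

variable [Fintype A]

lemma abs_sub_le_two_mul_tvDist (p q : A → ℝ) (a : A) : |p a - q a| ≤ 2 * tvDist p q := by
  rw [tvDist, mul_div_cancel₀ _ two_ne_zero]
  exact Finset.single_le_sum (f := fun a => |p a - q a|) (fun _ _ => abs_nonneg _)
    (Finset.mem_univ a)

/-- Convergence in probability of the empirical distribution implies convergence of its mean. -/
lemma abs_sum_mul_empDist_sub_le {n : ℕ} {P : Ω → ℝ} (hP : IsPMF P) (W : Ω → Fin n → A)
    {p : A → ℝ} (hp : IsPMF p) {δ : ℝ} (hδ : 0 ≤ δ) (a : A) :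
    |∑ ω, P ω * empDist (W ω) a - p a| ≤
      2 * δ + prob P {ω | δ < tvDist (empDist (W ω)) p} := by
  have hp1 : p a ≤ 1 := hp.2 ▸ Finset.single_le_sum (fun a _ => hp.1 a) (Finset.mem_univ a)
  have h0 : ∑ ω, P ω * empDist (W ω) a - p a = ∑ ω, P ω * (empDist (W ω) a - p a) := by
    simp_rw [mul_sub, Finset.sum_sub_distrib, ← Finset.sum_mul, hP.2, one_mul]
  have h1 : 2 * δ = ∑ ω, P ω * (2 * δ) := by rw [← Finset.sum_mul, hP.2, one_mul]
  rw [h0, h1, prob, ← Finset.sum_add_distrib]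
  refine (Finset.abs_sum_le_sum_abs _ _).trans (Finset.sum_le_sum fun ω _ => ?_)
  rw [abs_mul, abs_of_nonneg (hP.1 ω)]
  by_cases h : δ < tvDist (empDist (W ω)) p
  · rw [Set.indicator_of_mem (by exact h), ← mul_add_one]
    refine mul_le_mul_of_nonneg_left (abs_le.2 ⟨?_, ?_⟩) (hP.1 ω) <;>
      linarith [empDist_nonneg (W ω) a, empDist_le_one (W ω) a, hp.1 a]
  · rw [Set.indicator_of_notMem (by simpa using h), add_zero]
    exact mul_le_mul_of_nonneg_left ((abs_sub_le_two_mul_tvDist _ _ a).trans (by linarith))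
      (hP.1 ω)

end Approximation

/-- **Theorem 3 (Strictly causal encoder, converse).**
If the pmf `P` on `S × X × Y × Ŝ` is achievable with a strictly causal encoder,
then there exist a finite set `𝒱 = Fin m` and a joint pmf `Q` on
`S × X × Y × Ŝ × 𝒱` whose `(S,X,Y,Ŝ)`-marginal is `P`, which factors as
`P_S · P_X · P_{V|XS} · P_{Y|X} · P_{Ŝ|VY}`, and which satisfies
`I(X,V;S) ≤ I(X,V;Y)`. -/
theorem strictly_causal_converse
    {S X Y Z : Type} [Fintype S] [Fintype X] [Fintype Y] [Fintype Z]
    (PS : S → ℝ) (PYX : X → Y → ℝ)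
    (hPS : IsPMF PS) (hPYX : ∀ x, IsPMF (PYX x))
    (P : S × X × Y × Z → ℝ) (hP : IsPMF P)
    (hach : Achievable PS PYX EncoderClass.strictlyCausal P) :
    ∃ (m : ℕ) (PX : X → ℝ) (PVgXS : X → S → Fin m → ℝ)
      (PZgVY : Fin m → Y → Z → ℝ) (Q : S × X × Y × Z × Fin m → ℝ),
      IsPMF PX ∧
      (∀ x s, IsPMF (PVgXS x s)) ∧
      (∀ v y, IsPMF (PZgVY v y)) ∧
      (∀ s x y z v,
        Q (s, x, y, z, v) = PS s * PX x * PVgXS x s v * PYX x y * PZgVY v y z) ∧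
      (∀ s x y z, P (s, x, y, z) = ∑ v, Q (s, x, y, z, v)) ∧
      mutInfo Q (fun ω => (ω.2.1, ω.2.2.2.2)) (fun ω => ω.1)
        ≤ mutInfo Q (fun ω => (ω.2.1, ω.2.2.2.2)) (fun ω => ω.2.2.1) := by
  classical
  have hclosed : IsClosed (jointLaw PYX ''
      (admissibleLaws PS PYX : Set (X × (Y → Z) × S → ℝ))) :=
    ((isCompact_admissibleLaws PS PYX).image (continuous_jointLaw PYX)).isClosed
  have hmem : P ∈ jointLaw PYX '' (admissibleLaws PS PYX : Set (X × (Y → Z) × S → ℝ)) := by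
    refine hclosed.closure_subset (Metric.mem_closure_iff.2 fun ε hε => ?_)
    obtain ⟨n, hn, f, g, hf, hprob⟩ := hach (ε / 4) (by positivity)
    refine ⟨_, ⟨_, letterLaw_mem_admissibleLaws (g := g) hPS hPYX hn hf, rfl⟩, ?_⟩
    rw [dist_comm, dist_pi_lt_iff hε]
    intro a
    have h := abs_sum_mul_empDist_sub_le
      ⟨inducedP_nonneg hPS hPYX, sum_inducedP (f := f) hPS hPYX⟩
      (fun ω i => (ω.1 i, f i ω.1, ω.2 i, g i ω.2)) hP (by positivity : 0 ≤ ε / 4) a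
    rw [sum_mul_empDist, ← jointLaw_letterLaw hPYX] at h
    rw [Real.dist_eq]
    linarith
  obtain ⟨r, hr, rfl⟩ := hmem
  exact exists_auxiliary_of_mem_admissibleLaws hPS hPYX hr

end
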